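/- Let A be an even tensor with respect to Z = diag(I_{D_e}, −I_{D_o}) that is graded irreducible, and suppose there exists a nonzero proper orthogonal projector P ∈ M_D(ℂ) (necessarily not commuting with Z) with A^i P = P A^i P for all i. Then D_e = D_o = D/2, and there exists an invertible matrix Y ∈ M_D(ℂ) with Y Z = Z Y such that, identifying ℂ^D = ℂ² ⊗ ℂ^{D/2} so that Z = σ^z ⊗ I_{D/2}, one has Y A^i Y^{−1} = (σ^x)^{|i|} ⊗ B^i for some matrices B^i ∈ M_{D/2}(ℂ). Moreover: (1) there exists i with |i| = 1 and B^i ≠ 0; (2) there is no nonzero proper subspace of ℂ^{D/2} invariant under all the matrices B^i; (3) there is no nonzero proper subspace of ℂ^{D/2} invariant under all products B^{i₁}···B^{i_p} with Σ_{r=1}^p |i_r| even. -/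

import Mathlib

open Matrix Kronecker
open scoped ComplexOrder

namespace FQCA

noncomputable section

/-- The sign `(-1)^x` associated with a parity `x ∈ ℤ₂`. -/
def sgn (x : ZMod 2) : ℂ := (-1 : ℂ) ^ x.val

/-- Entrywise complex conjugation of a matrix. -/
def mconj {m n : Type*} (A : Matrix m n ℂ) : Matrix m n ℂ := A.map (starRingEnd ℂ)

/-- A diagonal matrix with diagonal entries `±1`. -/
def IsParityMatrix {ν : Type*} (Z : Matrix ν ν ℂ) : Prop :=
  Z.IsDiag ∧ ∀ α, Z α α = 1 ∨ Z α α = -1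

/-- An even tensor: `Z * A i = (-1)^{|i|} A i * Z`. -/
def EvenTensor {ι ν : Type*} [Fintype ν] (p : ι → ZMod 2)
    (A : ι → Matrix ν ν ℂ) (Z : Matrix ν ν ℂ) : Prop :=
  ∀ i, Z * A i = sgn (p i) • (A i * Z)

/-- The transfer matrix `E_A = Σ_i A^i ⊗ conj (A^i)`. -/
def transfer {ι ν : Type*} [Fintype ι] (A : ι → Matrix ν ν ℂ) :
    Matrix (ν × ν) (ν × ν) ℂ :=
  ∑ i, (A i) ⊗ₖ (mconj (A i))

/-- `P` is the orthogonal projector of a nonzero proper graded invariant subspace for `A`. -/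
def GradedInvariantProj {ι ν : Type*} [Fintype ν] [DecidableEq ν]
    (A : ι → Matrix ν ν ℂ) (Z P : Matrix ν ν ℂ) : Prop :=
  P * P = P ∧ Pᴴ = P ∧ P ≠ 0 ∧ P ≠ 1 ∧ P * Z = Z * P ∧ ∀ i, A i * P = P * (A i * P)

/-- A graded irreducible tensor: no nonzero proper graded invariant subspace. -/
def GradedIrreducible {ι ν : Type*} [Fintype ν] [DecidableEq ν]
    (A : ι → Matrix ν ν ℂ) (Z : Matrix ν ν ℂ) : Prop :=
  ¬ ∃ P, GradedInvariantProj A Z P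

/-- A graded normal tensor, `mult = 1` (non-degenerate) or `2` (degenerate):
graded irreducible, `1` is an eigenvalue of the transfer matrix of algebraic multiplicity
`mult`, and all other eigenvalues have modulus `< 1`. -/
def GradedNormal {ι ν : Type*} [Fintype ι] [Fintype ν] [DecidableEq ν]
    (A : ι → Matrix ν ν ℂ) (Z : Matrix ν ν ℂ) (mult : ℕ) : Prop :=
  GradedIrreducible A Z ∧
  (Matrix.charpoly (transfer A)).rootMultiplicity 1 = mult ∧
  ∀ μ ∈ spectrum ℂ (transfer A), μ ≠ 1 → ‖μ‖ < 1

/-- Graded Canonical Form: `A^i = ⊕ₖ μₖ Aₖ^i` with `Z` block diagonal in the same way and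
every block a graded normal tensor. -/
def GCF {ι ν : Type*} [Fintype ι] [Fintype ν] [DecidableEq ν]
    (p : ι → ZMod 2) (A : ι → Matrix ν ν ℂ) (Z : Matrix ν ν ℂ) : Prop :=
  ∃ (g : ℕ) (Dk : Fin g → ℕ) (e : ν ≃ ((k : Fin g) × Fin (Dk k)))
    (μ : Fin g → ℂ)
    (Ak : (k : Fin g) → ι → Matrix (Fin (Dk k)) (Fin (Dk k)) ℂ)
    (Zk : (k : Fin g) → Matrix (Fin (Dk k)) (Fin (Dk k)) ℂ),
    0 < g ∧
    (∀ i, Matrix.reindex e e (A i) = Matrix.blockDiagonal' (fun k => μ k • Ak k i)) ∧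
    Matrix.reindex e e Z = Matrix.blockDiagonal' Zk ∧
    ∀ k, IsParityMatrix (Zk k) ∧ EvenTensor p (Ak k) (Zk k) ∧
      (GradedNormal (Ak k) (Zk k) 1 ∨ GradedNormal (Ak k) (Zk k) 2)

/-- The coefficient `tr(A^{n₁} ⋯ A^{n_N})` of the fMPS with antiperiodic boundary
conditions generated by the tensor `A`. -/
def mpsCoeff {ι ν : Type*} [Fintype ν] [DecidableEq ν] {N : ℕ}
    (A : ι → Matrix ν ν ℂ) (n : Fin N → ι) : ℂ :=
  ((List.ofFn fun j => A (n j)).prod).trace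

/-- The fermionic sign `σ(n,m) = Σ_{k<j} (|n_j|+|m_j|)·|m_k|` of an fMPO matrix element. -/
def mpoSign {ι : Type*} (p : ι → ZMod 2) {N : ℕ} (n m : Fin N → ι) : ZMod 2 :=
  ∑ jk ∈ Finset.univ.filter (fun jk : Fin N × Fin N => jk.2 < jk.1),
    (p (n jk.1) + p (m jk.1)) * p (m jk.2)

/-- The fMPO with antiperiodic boundary conditions generated by the MPO tensor `U`. -/
def fMPO {ι : Type*} (p : ι → ZMod 2) {ν : Type*} [Fintype ν] [DecidableEq ν]
    (U : ι → ι → Matrix ν ν ℂ) (N : ℕ) :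
    Matrix (Fin N → ι) (Fin N → ι) ℂ :=
  Matrix.of fun n m =>
    sgn (mpoSign p n m) * ((List.ofFn fun j => U (n j) (m j)).prod).trace

/-- The fMPO with periodic boundary conditions generated by the MPO tensor `U`
(parity operator `Z` inserted in the trace). -/
def fMPO_PBC {ι : Type*} (p : ι → ZMod 2) {ν : Type*} [Fintype ν] [DecidableEq ν]
    (Z : Matrix ν ν ℂ) (U : ι → ι → Matrix ν ν ℂ) (N : ℕ) :
    Matrix (Fin N → ι) (Fin N → ι) ℂ :=
  Matrix.of fun n m =>
    sgn (mpoSign p n m) * (Z * (List.ofFn fun j => U (n j) (m j)).prod).trace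

/-- The fermionic blocking sign `τ(n,m) = Σ_{j<l} |m_j|·(|n_l|+|m_l|)`. -/
def blockSign {ι : Type*} (p : ι → ZMod 2) {q : ℕ} (n m : Fin q → ι) : ZMod 2 :=
  ∑ jl ∈ Finset.univ.filter (fun jl : Fin q × Fin q => jl.1 < jl.2),
    p (m jl.1) * (p (n jl.2) + p (m jl.2))

/-- The `q`-fold blocked MPO tensor, with the fermionic blocking signs. -/
def blocked {ι : Type*} (p : ι → ZMod 2) {ν : Type*} [Fintype ν] [DecidableEq ν]
    (U : ι → ι → Matrix ν ν ℂ) (q : ℕ) :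
    (Fin q → ι) → (Fin q → ι) → Matrix ν ν ℂ :=
  fun n m => sgn (blockSign p n m) • ((List.ofFn fun j => U (n j) (m j)).prod)

/-- The right rank `r(U)`: rank of the matrix with entry
`(-1)^{|n||m|} (U^{n,m})_{α,β}` in row `(n,β)` and column `(m,α)`. -/
def rightRank {ι ν : Type*} [Fintype ι] [Fintype ν]
    (p : ι → ZMod 2) (U : ι → ι → Matrix ν ν ℂ) : ℕ :=
  (Matrix.of fun (r c : ι × ν) => sgn (p r.1 * p c.1) * U r.1 c.1 c.2 r.2).rank

/-- The left rank `ℓ(U)`: rank of the matrix with entry `(U^{n,m})_{α,β}`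
in row `(n,α)` and column `(m,β)`. -/
def leftRank {ι ν : Type*} [Fintype ι] [Fintype ν]
    (U : ι → ι → Matrix ν ν ℂ) : ℕ :=
  (Matrix.of fun (r c : ι × ν) => U r.1 c.1 r.2 c.2).rank

/-- The Pauli matrix `σˣ`, indexed by `Bool`. -/
def pauliX : Matrix Bool Bool ℂ := Matrix.of fun a b => if a = b then 0 else 1

/-- The Pauli matrix `σᶻ`, indexed by `Bool`. -/
def pauliZ : Matrix Bool Bool ℂ := Matrix.diagonal (fun b => if b then -1 else 1)

/-- The single-site physical parity matrix `P = diag((-1)^{|i|})`. -/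
def singleP {ι : Type*} [DecidableEq ι] (p : ι → ZMod 2) : Matrix ι ι ℂ :=
  Matrix.diagonal (fun i => sgn (p i))

/-- The parity of the doubled physical index `(n,m)` of an MPO tensor. -/
def doubledP {ι : Type*} (p : ι → ZMod 2) : ι × ι → ZMod 2 :=
  fun nm => p nm.1 + p nm.2

/-- An MPO tensor regarded as a tensor in the doubled physical index. -/
def doubledT {ι ν : Type*} (U : ι → ι → Matrix ν ν ℂ) : ι × ι → Matrix ν ν ℂ :=
  fun nm => U nm.1 nm.2

/-- An MPO tensor rescaled by `c`, regarded as a tensor in the doubled physical index. -/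
def mpoScaled {ι ν : Type*} (c : ℂ) (U : ι → ι → Matrix ν ν ℂ) : ι × ι → Matrix ν ν ℂ :=
  fun nm => c • U nm.1 nm.2

/-- The parity operator `σᶻ ⊗ I` on the bond space `Bool × Fin b`. -/
def ZBP (b : ℕ) : Matrix (Bool × Fin b) (Bool × Fin b) ℂ :=
  pauliZ ⊗ₖ (1 : Matrix (Fin b) (Fin b) ℂ)

/-- Structure of a type II MPO tensor: `U^{n,m} = (σˣ)^{|n|+|m|} ⊗ N^{n,m}`. -/
def TypeIIStruct {d b : ℕ} (p : Fin d → ZMod 2)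
    (U : Fin d → Fin d → Matrix (Bool × Fin b) (Bool × Fin b) ℂ) : Prop :=
  ∃ Nm : Fin d → Fin d → Matrix (Fin b) (Fin b) ℂ,
    ∀ n m', U n m' = (pauliX ^ (p n + p m').val) ⊗ₖ Nm n m'

/-- The parity matrix of the product grading on `q` sites. -/
def bigP {d : ℕ} (p : Fin d → ZMod 2) (q : ℕ) :
    Matrix (Fin q → Fin d) (Fin q → Fin d) ℂ :=
  Matrix.diagonal (fun n => sgn (∑ i, p (n i)))

/-- The Jordan-Wigner embedding at site `j` of a local operator `O` homogeneous of
parity `o`: `P^{|O|} ⊗ ⋯ ⊗ P^{|O|} ⊗ O ⊗ I ⊗ ⋯ ⊗ I`. -/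
def jordanWigner {d N : ℕ} (p : Fin d → ZMod 2) (o : ZMod 2)
    (O : Matrix (Fin d) (Fin d) ℂ) (j : Fin N) :
    Matrix (Fin N → Fin d) (Fin N → Fin d) ℂ :=
  Matrix.of fun n m =>
    (∏ l ∈ Finset.univ.filter (fun l : Fin N => l < j),
      ((singleP p) ^ o.val) (n l) (m l)) *
    O (n j) (m j) *
    (∏ l ∈ Finset.univ.filter (fun l : Fin N => j < l),
      (if n l = m l then (1:ℂ) else 0))

/-- The identification `ℂ^{D_e} ⊕ ℂ^{D_o} ≃ ℂ² ⊗ ℂ^{D_e}` (given `D_o = D_e`), under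
which `Z = diag(I,-I)` becomes `σᶻ ⊗ I`. -/
def sumToBP {De Do : ℕ} (h : Do = De) : (Fin De ⊕ Fin Do) ≃ Bool × Fin De :=
  (Equiv.sumCongr (Equiv.refl (Fin De)) (finCongr h)).trans
    (Equiv.boolProdEquivSum (Fin De)).symm

/-- A graded irreducible tensor has no nontrivial invariant subspace that is also stable under
the (Hermitian) parity matrix. -/
theorem GradedIrreducible.eq_bot_or_eq_top {ι ν : Type*} [Fintype ν] [DecidableEq ν]
    {A : ι → Matrix ν ν ℂ} {Z : Matrix ν ν ℂ} (hirr : GradedIrreducible A Z)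
    (hZ : Z.IsHermitian) (W : Submodule ℂ (ν → ℂ)) (hWZ : ∀ v ∈ W, Z *ᵥ v ∈ W)
    (hWA : ∀ i, ∀ v ∈ W, A i *ᵥ v ∈ W) : W = ⊥ ∨ W = ⊤ := by
  by_contra hW
  rw [not_or] at hW
  let K : Submodule ℂ (EuclideanSpace ℂ ν) := W.comap (WithLp.linearEquiv 2 ℂ (ν → ℂ)).toLinearMap
  let Q : Matrix ν ν ℂ := (toEuclideanCLM (n := ν) (𝕜 := ℂ)).symm K.starProjection
  have hQ : ∀ v, Q *ᵥ v = (K.starProjection (WithLp.toLp 2 v)).ofLp := fun v => by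
    have h := ofLp_toEuclideanCLM (𝕜 := ℂ) Q (WithLp.toLp 2 v)
    rw [StarAlgEquiv.apply_symm_apply] at h
    exact h.symm
  have hQmem : ∀ v, Q *ᵥ v ∈ W := fun v => by
    rw [hQ]
    exact K.starProjection_apply_mem (WithLp.toLp 2 v)
  have hQid : ∀ v ∈ W, Q *ᵥ v = v := fun v hv => by
    rw [hQ, Submodule.starProjection_eq_self_iff.2 (show WithLp.toLp 2 v ∈ K from hv)]
  have hinv : ∀ M : Matrix ν ν ℂ, (∀ v ∈ W, M *ᵥ v ∈ W) → M * Q = Q * (M * Q) := fun M hM => by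
    refine ext_iff_mulVec.2 fun v => ?_
    rw [← mulVec_mulVec v Q, hQid]
    rw [← mulVec_mulVec]
    exact hM _ (hQmem v)
  have hQH : Qᴴ = Q := by
    change star ((toEuclideanCLM (n := ν) (𝕜 := ℂ)).symm K.starProjection) = _
    exact ((toEuclideanCLM (n := ν) (𝕜 := ℂ)).symm.map_star' _).symm.trans
      (congrArg _ (isSelfAdjoint_starProjection K).star_eq)
  have hZQ := hinv Z hWZ
  refine hirr ⟨Q, ?_, hQH, ?_, ?_, ?_, fun i => hinv _ (hWA i)⟩
  · exact ext_iff_mulVec.2 fun v => by rw [← mulVec_mulVec, hQid _ (hQmem v)]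
  · intro h
    refine hW.1 ((Submodule.eq_bot_iff _).2 fun v hv => ?_)
    rw [← hQid v hv, h, zero_mulVec]
  · intro h
    refine hW.2 (eq_top_iff.2 fun v _ => ?_)
    simpa [h] using hQmem v
  · have h := congrArg conjTranspose hZQ
    simp only [conjTranspose_mul, hQH, hZ.eq] at h
    rw [h, hZQ, Matrix.mul_assoc]

/-- A subspace `S` complementary to its image under `diag(1, -1)` is the graph of a linear
equivalence. -/
theorem exists_linearEquiv_graph {m n : Type*} (S : Submodule ℂ (m ⊕ n → ℂ))
    (hdisj : ∀ v ∈ S, Sum.elim (v ∘ Sum.inl) (-(v ∘ Sum.inr)) ∈ S → v = 0)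
    (hspan : ∀ v : m ⊕ n → ℂ, ∃ s ∈ S, ∃ t ∈ S,
      v = s + Sum.elim (t ∘ Sum.inl) (-(t ∘ Sum.inr))) :
    ∃ T : (m → ℂ) ≃ₗ[ℂ] (n → ℂ), ∀ v, v ∈ S ↔ v ∘ Sum.inr = T (v ∘ Sum.inl) := by
  let L := (LinearMap.funLeft ℂ ℂ (Sum.inl : m → m ⊕ n)) ∘ₗ S.subtype
  let R := (LinearMap.funLeft ℂ ℂ (Sum.inr : n → m ⊕ n)) ∘ₗ S.subtype
  have hL : Function.Bijective L := by
    constructor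
    · refine (injective_iff_map_eq_zero L).2 fun v hv => Subtype.ext (hdisj v v.2 ?_)
      have h0 : (v : m ⊕ n → ℂ) ∘ Sum.inl = 0 := hv
      convert S.neg_mem v.2 using 1
      ext (i | i)
      · simp [show (v : m ⊕ n → ℂ) (Sum.inl i) = 0 from congrFun h0 i]
      · simp
    · intro x
      obtain ⟨s, hs, t, ht, h⟩ := hspan (Sum.elim x 0)
      refine ⟨⟨s, hs⟩ + ⟨t, ht⟩, ?_⟩
      ext i
      simpa [L, LinearMap.funLeft] using (congrFun h (Sum.inl i)).symm
  have hR : Function.Bijective R := by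
    constructor
    · refine (injective_iff_map_eq_zero R).2 fun v hv => Subtype.ext (hdisj v v.2 ?_)
      have h0 : (v : m ⊕ n → ℂ) ∘ Sum.inr = 0 := hv
      convert v.2 using 1
      ext (i | i)
      · simp
      · simp [show (v : m ⊕ n → ℂ) (Sum.inr i) = 0 from congrFun h0 i]
    · intro x
      obtain ⟨s, hs, t, ht, h⟩ := hspan (Sum.elim 0 x)
      refine ⟨⟨s, hs⟩ - ⟨t, ht⟩, ?_⟩
      ext i
      simpa [R, LinearMap.funLeft, sub_eq_add_neg] using (congrFun h (Sum.inr i)).symm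
  let eL := LinearEquiv.ofBijective L hL
  refine ⟨eL.symm.trans (LinearEquiv.ofBijective R hR), fun v => ⟨fun hv => ?_, fun hv => ?_⟩⟩
  · have h : eL.symm (v ∘ Sum.inl) = ⟨v, hv⟩ := eL.symm_apply_eq.2 rfl
    simp only [LinearEquiv.trans_apply, h]
    rfl
  · have h : L (eL.symm (v ∘ Sum.inl)) = v ∘ Sum.inl := eL.apply_symm_apply _
    convert (eL.symm (v ∘ Sum.inl)).2 using 1
    ext (i | i)
    · exact (congrFun h i).symm
    · exact congrFun hv i

theorem parity_mulVec {m n : Type*} [Fintype m] [Fintype n] [DecidableEq m] [DecidableEq n]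
    (v : m ⊕ n → ℂ) :
    fromBlocks (1 : Matrix m m ℂ) 0 0 (-(1 : Matrix n n ℂ)) *ᵥ v =
      Sum.elim (v ∘ Sum.inl) (-(v ∘ Sum.inr)) := by
  simp [fromBlocks_mulVec, neg_mulVec]

theorem eq_zero_of_eq_neg {m n : Type*} {X : Matrix m n ℂ} (h : X = -X) : X = 0 := by
  ext i j
  exact self_eq_neg.1 (congrFun (congrFun h i) j)

/-- A matrix commuting with `diag(1, -1)` up to the sign of a parity is block diagonal or block
off-diagonal. -/
theorem eq_fromBlocks_of_parity {m n : Type*} [Fintype m] [Fintype n] [DecidableEq m]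
    [DecidableEq n] {q : ZMod 2} {M : Matrix (m ⊕ n) (m ⊕ n) ℂ}
    (h : fromBlocks (1 : Matrix m m ℂ) 0 0 (-(1 : Matrix n n ℂ)) * M =
      sgn q • (M * fromBlocks (1 : Matrix m m ℂ) 0 0 (-(1 : Matrix n n ℂ)))) :
    (q = 0 → M = fromBlocks M.toBlocks₁₁ 0 0 M.toBlocks₂₂) ∧
      (q = 1 → M = fromBlocks 0 M.toBlocks₁₂ M.toBlocks₂₁ 0) := by
  rw [← fromBlocks_toBlocks M] at h ⊢
  simp only [fromBlocks_multiply, fromBlocks_smul, fromBlocks_inj] at h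
  obtain ⟨h₁, h₂, h₃, h₄⟩ := h
  simp only [Matrix.one_mul, Matrix.mul_one, Matrix.zero_mul, Matrix.mul_zero, add_zero, zero_add,
    Matrix.neg_mul, Matrix.mul_neg] at h₁ h₂ h₃ h₄
  constructor
  · rintro rfl
    simp only [sgn, ZMod.val_zero, pow_zero, one_smul] at h₂ h₃
    simp [eq_zero_of_eq_neg h₂, eq_zero_of_eq_neg h₃.symm]
  · rintro rfl
    simp only [sgn, ZMod.val_one, pow_one, neg_smul, one_smul, neg_neg] at h₁ h₄
    simp [eq_zero_of_eq_neg h₁, eq_zero_of_eq_neg h₄.symm]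

theorem zmod_two_cases (q : ZMod 2) : q = 0 ∨ q = 1 := by
  revert q
  decide

/-- If `A` leaves the graph of an invertible `M` invariant, then up to the even gauge
`diag(1, M⁻¹)` it has the form `(σˣ)^{|i|} ⊗ B^i`. -/
theorem exists_blocks_of_graph {d b : ℕ} (p : Fin d → ZMod 2)
    {A : Fin d → Matrix (Fin b ⊕ Fin b) (Fin b ⊕ Fin b) ℂ}
    (hA : EvenTensor p A (fromBlocks 1 0 0 (-1))) {S : Submodule ℂ (Fin b ⊕ Fin b → ℂ)}
    (hS : ∀ i, ∀ v ∈ S, A i *ᵥ v ∈ S) {M N : Matrix (Fin b) (Fin b) ℂ} (hMN : M * N = 1)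
    (hSM : ∀ v, v ∈ S ↔ v ∘ Sum.inr = M *ᵥ (v ∘ Sum.inl)) :
    ∃ B : Fin d → Matrix (Fin b) (Fin b) ℂ, ∀ i,
      (p i = 0 → A i = fromBlocks (B i) 0 0 (M * B i * N)) ∧
      (p i = 1 → A i = fromBlocks 0 (B i * N) (M * B i) 0) := by
  have key : ∀ i x, (A i *ᵥ Sum.elim x (M *ᵥ x)) ∘ Sum.inr =
      M *ᵥ ((A i *ᵥ Sum.elim x (M *ᵥ x)) ∘ Sum.inl) := fun i x =>
    (hSM _).1 (hS i _ ((hSM _).2 (by simp)))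
  refine ⟨fun i => if p i = 0 then (A i).toBlocks₁₁ else (A i).toBlocks₁₂ * M, fun i => ⟨?_, ?_⟩⟩
  · intro h
    have hblk := (eq_fromBlocks_of_parity (hA i)).1 h
    have h' : (A i).toBlocks₂₂ * M = M * (A i).toBlocks₁₁ := ext_iff_mulVec.2 fun x => by
      have := key i x
      rw [hblk] at this
      simpa [fromBlocks_mulVec] using this
    simp only [if_pos h]
    rw [← h', Matrix.mul_assoc, hMN, Matrix.mul_one]
    exact hblk
  · intro h
    have hblk := (eq_fromBlocks_of_parity (hA i)).2 h
    have h' : (A i).toBlocks₂₁ = M * ((A i).toBlocks₁₂ * M) := ext_iff_mulVec.2 fun x => by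
      have := key i x
      rw [hblk] at this
      simpa [fromBlocks_mulVec] using this
    have h1 : p i ≠ 0 := by simp [h]
    simp only [if_neg h1]
    rw [← h', Matrix.mul_assoc, hMN, Matrix.mul_one]
    exact hblk

/-- Graded irreducibility of `A^i = (σˣ)^{|i|} ⊗ B^i` (up to an even gauge), in terms of pairs of
subspaces of the even and odd sectors. -/
theorem GradedIrreducible.pair_trivial {d b : ℕ} {p : Fin d → ZMod 2}
    {A : Fin d → Matrix (Fin b ⊕ Fin b) (Fin b ⊕ Fin b) ℂ}
    (hirr : GradedIrreducible A (fromBlocks 1 0 0 (-1))) {M N : Matrix (Fin b) (Fin b) ℂ}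
    (hMN : M * N = 1) {B : Fin d → Matrix (Fin b) (Fin b) ℂ}
    (hB : ∀ i, (p i = 0 → A i = fromBlocks (B i) 0 0 (M * B i * N)) ∧
      (p i = 1 → A i = fromBlocks 0 (B i * N) (M * B i) 0))
    (W W' : Submodule ℂ (Fin b → ℂ))
    (h0 : ∀ i, p i = 0 → ∀ v ∈ W, B i *ᵥ v ∈ W) (h0' : ∀ i, p i = 0 → ∀ v ∈ W', B i *ᵥ v ∈ W')
    (h1 : ∀ i, p i = 1 → ∀ v ∈ W, B i *ᵥ v ∈ W') (h1' : ∀ i, p i = 1 → ∀ v ∈ W', B i *ᵥ v ∈ W) :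
    (W = ⊥ ∧ W' = ⊥) ∨ (W = ⊤ ∧ W' = ⊤) := by
  have hNM : N * M = 1 := mul_eq_one_comm.1 hMN
  let U : Submodule ℂ (Fin b ⊕ Fin b → ℂ) :=
    W.comap (LinearMap.funLeft ℂ ℂ Sum.inl) ⊓
      (W'.comap N.mulVecLin).comap (LinearMap.funLeft ℂ ℂ Sum.inr)
  have hU : ∀ v, v ∈ U ↔ v ∘ Sum.inl ∈ W ∧ N *ᵥ (v ∘ Sum.inr) ∈ W' := fun v => Iff.rfl
  have hpair : ∀ x ∈ W, ∀ y ∈ W', Sum.elim x (M *ᵥ y) ∈ U := fun x hx y hy => by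
    rw [hU]
    simpa [mulVec_mulVec, hNM] using ⟨hx, hy⟩
  have hZ : (fromBlocks 1 0 0 (-1) : Matrix (Fin b ⊕ Fin b) (Fin b ⊕ Fin b) ℂ).IsHermitian := by
    simp [IsHermitian, fromBlocks_conjTranspose]
  refine (hirr.eq_bot_or_eq_top hZ U ?_ ?_).imp ?_ ?_
  · intro v hv
    rw [parity_mulVec, hU]
    simpa [mulVec_neg] using (hU v).1 hv
  · intro i v hv
    obtain ⟨hl, hr⟩ := (hU v).1 hv
    rw [hU]
    rcases zmod_two_cases (p i) with h | h
    · rw [(hB i).1 h]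
      have e : N * (M * B i * N) = B i * N := by
        rw [Matrix.mul_assoc, ← Matrix.mul_assoc, hNM, Matrix.one_mul]
      simpa [fromBlocks_mulVec, mulVec_mulVec, e] using
        ⟨h0 i h _ hl, by simpa [mulVec_mulVec] using h0' i h _ hr⟩
    · rw [(hB i).2 h]
      have e : N * (M * B i) = B i := by rw [← Matrix.mul_assoc, hNM, Matrix.one_mul]
      simpa [fromBlocks_mulVec, mulVec_mulVec, e] using
        ⟨by simpa [mulVec_mulVec] using h1' i h _ hr, h1 i h _ hl⟩
  · intro h
    refine ⟨(Submodule.eq_bot_iff _).2 fun x hx => ?_, (Submodule.eq_bot_iff _).2 fun y hy => ?_⟩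
    · have := hpair x hx 0 W'.zero_mem
      rw [h, Submodule.mem_bot] at this
      exact congrArg (· ∘ Sum.inl) this
    · have := hpair 0 W.zero_mem y hy
      rw [h, Submodule.mem_bot] at this
      have h2 : M *ᵥ y = 0 := congrArg (· ∘ Sum.inr) this
      rw [← one_mulVec y, ← hNM, ← mulVec_mulVec, h2, mulVec_zero]
  · intro h
    have hall : ∀ v, v ∈ U := fun v => h ▸ Submodule.mem_top
    refine ⟨eq_top_iff.2 fun x _ => ((hU (Sum.elim x 0)).1 (hall _)).1,
      eq_top_iff.2 fun y _ => ?_⟩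
    simpa [mulVec_mulVec, hNM] using ((hU (Sum.elim 0 (M *ᵥ y))).1 (hall _)).2

/-- An invariant subspace of a graded irreducible tensor is complementary to its image under the
parity, hence the graph of an invertible map from the even to the odd sector. -/
theorem GradedIrreducible.exists_graph {d : ℕ} {m n : Type*} [Fintype m] [Fintype n]
    [DecidableEq m] [DecidableEq n] {p : Fin d → ZMod 2}
    {A : Fin d → Matrix (m ⊕ n) (m ⊕ n) ℂ} (hA : EvenTensor p A (fromBlocks 1 0 0 (-1)))
    (hirr : GradedIrreducible A (fromBlocks 1 0 0 (-1))) {S : Submodule ℂ (m ⊕ n → ℂ)}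
    (hbot : S ≠ ⊥) (htop : S ≠ ⊤) (hS : ∀ i, ∀ v ∈ S, A i *ᵥ v ∈ S) :
    ∃ T : (m → ℂ) ≃ₗ[ℂ] (n → ℂ), ∀ v, v ∈ S ↔ v ∘ Sum.inr = T (v ∘ Sum.inl) := by
  set Z : Matrix (m ⊕ n) (m ⊕ n) ℂ := fromBlocks 1 0 0 (-1) with hZdef
  have hZ : Z.IsHermitian := by simp [Z, IsHermitian, fromBlocks_conjTranspose]
  have hZZ : Z * Z = 1 := by simp [Z, fromBlocks_multiply]
  have hZv : ∀ v, Z *ᵥ (Z *ᵥ v) = v := fun v => by rw [mulVec_mulVec, hZZ, one_mulVec]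
  let S' := S.comap Z.mulVecLin
  have hS' : ∀ v, v ∈ S' ↔ Z *ᵥ v ∈ S := fun v => Iff.rfl
  have hS'A : ∀ i, ∀ v ∈ S', A i *ᵥ v ∈ S' := fun i v hv => by
    rw [hS', mulVec_mulVec, hA i, smul_mulVec, ← mulVec_mulVec]
    exact S.smul_mem _ (hS i _ hv)
  have hinf : S ⊓ S' = ⊥ := by
    refine (hirr.eq_bot_or_eq_top hZ (S ⊓ S') ?_ ?_).resolve_right fun h =>
      htop (top_le_iff.1 (h ▸ inf_le_left))
    · exact fun v hv => ⟨hv.2, (hS' _).2 (by rw [hZv]; exact hv.1)⟩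
    · exact fun i v hv => ⟨hS i v hv.1, hS'A i v hv.2⟩
  have hsup : S ⊔ S' = ⊤ := by
    refine (hirr.eq_bot_or_eq_top hZ (S ⊔ S') ?_ ?_).resolve_left fun h =>
      hbot (le_bot_iff.1 (h ▸ le_sup_left))
    · intro v hv
      obtain ⟨s, hs, t, ht, rfl⟩ := Submodule.mem_sup.1 hv
      rw [mulVec_add, add_comm]
      exact Submodule.add_mem_sup ht ((hS' _).2 (by rwa [hZv]))
    · intro i v hv
      obtain ⟨s, hs, t, ht, rfl⟩ := Submodule.mem_sup.1 hv
      rw [mulVec_add]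
      exact Submodule.add_mem_sup (hS i _ hs) (hS'A i _ ht)
  refine exists_linearEquiv_graph S (fun v hv hv' => ?_) fun v => ?_
  · rw [← parity_mulVec] at hv'
    exact (Submodule.mem_bot ℂ).1 (hinf ▸ (⟨hv, hv'⟩ : v ∈ S ⊓ S'))
  · obtain ⟨s, hs, t, ht, rfl⟩ := Submodule.mem_sup.1 (hsup ▸ Submodule.mem_top : v ∈ S ⊔ S')
    refine ⟨s, hs, Z *ᵥ t, ht, ?_⟩
    rw [← parity_mulVec, ← hZdef, hZv]

theorem reindex_sumToBP_even {b : ℕ} (B : Matrix (Fin b) (Fin b) ℂ) :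
    reindex (sumToBP rfl) (sumToBP rfl) (fromBlocks B 0 0 B) =
      (pauliX ^ (0 : ZMod 2).val) ⊗ₖ B := by
  ext ⟨x, i⟩ ⟨y, j⟩
  cases x <;> cases y <;> simp [sumToBP, finCongr]

theorem reindex_sumToBP_odd {b : ℕ} (B : Matrix (Fin b) (Fin b) ℂ) :
    reindex (sumToBP rfl) (sumToBP rfl) (fromBlocks 0 B B 0) =
      (pauliX ^ (1 : ZMod 2).val) ⊗ₖ B := by
  ext ⟨x, i⟩ ⟨y, j⟩
  cases x <;> cases y <;> simp [sumToBP, finCongr, pauliX, ZMod.val_one]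

theorem reindex_sumToBP_parity (b : ℕ) :
    reindex (sumToBP rfl) (sumToBP rfl)
        (fromBlocks (1 : Matrix (Fin b) (Fin b) ℂ) 0 0 (-(1 : Matrix (Fin b) (Fin b) ℂ))) =
      pauliZ ⊗ₖ (1 : Matrix (Fin b) (Fin b) ℂ) := by
  ext ⟨x, i⟩ ⟨y, j⟩
  cases x <;> cases y <;> simp [sumToBP, finCongr, pauliZ]

/-- A graded irreducible tensor admitting a (non-graded) invariant
subspace has `D_e = D_o` and, up to an even gauge, the form `A^i = (σˣ)^{|i|} ⊗ B^i`,
where the matrices `B^i` satisfy the listed irreducibility properties. -/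
theorem graded_irreducible_with_invariant_subspace {d De Do : ℕ} (p : Fin d → ZMod 2)
    (Z : Matrix (Fin De ⊕ Fin Do) (Fin De ⊕ Fin Do) ℂ)
    (hZ : Z = Matrix.fromBlocks (1 : Matrix (Fin De) (Fin De) ℂ) 0 0
        (-(1 : Matrix (Fin Do) (Fin Do) ℂ)))
    (A : Fin d → Matrix (Fin De ⊕ Fin Do) (Fin De ⊕ Fin Do) ℂ)
    (hA : EvenTensor p A Z)
    (hirr : GradedIrreducible A Z)
    (P : Matrix (Fin De ⊕ Fin Do) (Fin De ⊕ Fin Do) ℂ)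
    (hP : P * P = P ∧ Pᴴ = P ∧ P ≠ 0 ∧ P ≠ 1)
    (hPinv : ∀ i, A i * P = P * (A i * P)) :
    ∃ h : Do = De,
      ∃ Y : Matrix (Fin De ⊕ Fin Do) (Fin De ⊕ Fin Do) ℂ,
        IsUnit Y ∧ Y * Z = Z * Y ∧
        ∃ B : Fin d → Matrix (Fin De) (Fin De) ℂ,
          Matrix.reindex (sumToBP h) (sumToBP h) Z =
            pauliZ ⊗ₖ (1 : Matrix (Fin De) (Fin De) ℂ) ∧
          (∀ i, Matrix.reindex (sumToBP h) (sumToBP h) (Y * A i * Y⁻¹) =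
            (pauliX ^ (p i).val) ⊗ₖ B i) ∧
          (∃ i, p i = 1 ∧ B i ≠ 0) ∧
          (¬ ∃ W : Submodule ℂ (Fin De → ℂ), W ≠ ⊥ ∧ W ≠ ⊤ ∧
              ∀ i, ∀ v ∈ W, (B i).mulVec v ∈ W) ∧
          (¬ ∃ W : Submodule ℂ (Fin De → ℂ), W ≠ ⊥ ∧ W ≠ ⊤ ∧
              ∀ l : List (Fin d), (l.map p).sum = 0 →
                ∀ v ∈ W, ((l.map B).prod).mulVec v ∈ W) := by
  subst hZ
  obtain ⟨hPP, -, hP0, hP1⟩ := hP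
  have hSP : ∀ v ∈ LinearMap.range P.mulVecLin, P *ᵥ v = v := by
    rintro _ ⟨w, rfl⟩
    simp [mulVec_mulVec, hPP]
  have hS : ∀ i, ∀ v ∈ LinearMap.range P.mulVecLin, A i *ᵥ v ∈ LinearMap.range P.mulVecLin := by
    rintro i _ ⟨w, rfl⟩
    refine ⟨(A i * P) *ᵥ w, ?_⟩
    simp only [mulVecLin_apply, mulVec_mulVec, ← hPinv i]
  obtain ⟨T, hT⟩ := hirr.exists_graph hA (S := LinearMap.range P.mulVecLin)
    (fun h => hP0 (ext_iff_mulVec.2 fun v => by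
      have hv : P *ᵥ v ∈ LinearMap.range P.mulVecLin := ⟨v, rfl⟩
      rw [h, Submodule.mem_bot] at hv
      rw [hv, zero_mulVec]))
    (fun h => hP1 (ext_iff_mulVec.2 fun v => by
      rw [hSP v (h ▸ Submodule.mem_top), one_mulVec])) hS
  obtain rfl : Do = De := by simpa using T.finrank_eq.symm
  let M := LinearMap.toMatrix' T.toLinearMap
  let N := LinearMap.toMatrix' T.symm.toLinearMap
  have hMN : M * N = 1 := by simp [M, N, ← LinearMap.toMatrix'_comp]
  have hNM : N * M = 1 := mul_eq_one_comm.1 hMN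
  obtain ⟨B, hB⟩ := exists_blocks_of_graph p hA hS hMN fun v => by
    rw [hT v, LinearMap.toMatrix'_mulVec]
    rfl
  have hpair := hirr.pair_trivial hMN hB
  have hne : (⊥ : Submodule ℂ (Fin Do → ℂ)) ≠ ⊤ := fun h => by
    have := (Submodule.subsingleton_iff ℂ).1 (subsingleton_of_bot_eq_top h)
    have hD : IsEmpty (Fin Do) := by
      by_contra hD
      rw [not_isEmpty_iff] at hD
      exact not_subsingleton (Fin Do → ℂ) this
    exact hP0 (by ext i; exact (isEmptyElim i : False).elim)
  have heven : ¬ ∃ W : Submodule ℂ (Fin Do → ℂ), W ≠ ⊥ ∧ W ≠ ⊤ ∧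
      ∀ l : List (Fin d), (l.map p).sum = 0 → ∀ v ∈ W, ((l.map B).prod).mulVec v ∈ W := by
    rintro ⟨W, hW0, hW1, hW⟩
    let W' : Submodule ℂ (Fin Do → ℂ) :=
      ⨆ l : {l : List (Fin d) // (l.map p).sum = 1}, W.map ((l.1.map B).prod).mulVecLin
    have hW'mem : ∀ l : List (Fin d), (l.map p).sum = 1 → ∀ v ∈ W,
        (l.map B).prod *ᵥ v ∈ W' := fun l hl v hv =>
      Submodule.mem_iSup_of_mem ⟨l, hl⟩ ⟨v, hv, rfl⟩
    have hW'le : ∀ i (V : Submodule ℂ (Fin Do → ℂ)),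
        (∀ l : List (Fin d), (l.map p).sum = 1 → ∀ v ∈ W, ((i :: l).map B).prod *ᵥ v ∈ V) →
        ∀ v ∈ W', B i *ᵥ v ∈ V := fun i V h => by
      suffices W' ≤ V.comap (B i).mulVecLin from fun v hv => this hv
      refine iSup_le fun l => ?_
      rintro _ ⟨v, hv, rfl⟩
      simpa [mulVec_mulVec] using h l.1 l.2 v hv
    refine (hpair W W' (fun i hi v hv => ?_) (fun i hi => ?_) (fun i hi v hv => ?_)
      (fun i hi => ?_)).elim (fun h => hW0 h.1) (fun h => hW1 h.1)
    · simpa using hW [i] (by simpa using hi) v hv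
    · exact hW'le i W' fun l hl => hW'mem _ (by simp [hi, hl])
    · simpa using hW'mem [i] (by simpa using hi) v hv
    · exact hW'le i W fun l hl => hW _ (by simp [hi, hl]; decide)
  refine ⟨rfl, fromBlocks 1 0 0 N, ?_, ?_, B, reindex_sumToBP_parity _, fun i => ?_, ?_, ?_,
    heven⟩
  · exact IsUnit.of_mul_eq_one (fromBlocks 1 0 0 M) (by simp [fromBlocks_multiply, hNM])
  · simp [fromBlocks_multiply]
  · have hinv : (fromBlocks 1 0 0 N : Matrix (Fin Do ⊕ Fin Do) (Fin Do ⊕ Fin Do) ℂ)⁻¹ =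
        fromBlocks 1 0 0 M := inv_eq_right_inv (by simp [fromBlocks_multiply, hNM])
    rw [hinv]
    rcases zmod_two_cases (p i) with h | h
    · rw [h, ← reindex_sumToBP_even, (hB i).1 h]
      congr 1
      simp [fromBlocks_multiply, Matrix.mul_assoc, hNM]
      simp [← Matrix.mul_assoc, hNM]
    · rw [h, ← reindex_sumToBP_odd, (hB i).2 h]
      congr 1
      simp [fromBlocks_multiply, Matrix.mul_assoc, hNM]
      simp [← Matrix.mul_assoc, hNM]
  · by_contra! hodd
    rcases hpair ⊤ ⊥ (by simp) (by simp) (fun i hi => by simp [hodd i hi]) (by simp) with h | h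
    · exact hne h.1.symm
    · exact hne h.2
  · rintro ⟨W, hW0, hW1, hW⟩
    rcases hpair W W (fun i _ => hW i) (fun i _ => hW i) (fun i _ => hW i) (fun i _ => hW i)
      with h | h
    · exact hW0 h.1
    · exact hW1 h.1
end

end FQCA
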